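/- Let k ≥ 2. Then for every x ∈ [z_{1,k}, z_{1,k+1}), the smallest univoque base q_s(x) lies in (q_1, q_2) and is the unique root in (q_1, q_2) of the equation x = Σ_{i=1}^{k+1} q^{-i} + 1/(q^{k+1}(q² − 1)). Furthermore, for every x ∈ [z_2, z_{1,2}), q_s(x) lies in (q_1, q_2] and is the unique root in (q_1, q_2] of the equation x = 1/q + 1/q² + 1/(q²(q² − 1)). -/

import Mathlib

open Filter Topology

noncomputable section

/-- The value `Σ_{i≥0} d i / q^(i+1)` of a (0-indexed) digit sequence `d` in base `q`;
this corresponds to `((d_i)_{i≥1})_q` with `d_i = d (i-1)`. -/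
def seqVal (q : ℝ) (d : ℕ → ℕ) : ℝ := ∑' i : ℕ, (d i : ℝ) / q ^ (i + 1)

/-- `d` is a `q`-expansion of `x` with digits in `{0,1}`. -/
def IsExpansion (q x : ℝ) (d : ℕ → ℕ) : Prop :=
  (∀ i, d i ≤ 1) ∧ x = seqVal q d

/-- `x` has a unique `q`-expansion. -/
def HasUniqueExpansion (q x : ℝ) : Prop := ∃! d : ℕ → ℕ, IsExpansion q x d

/-- The set `U(x)` of univoque bases of `x`. -/
def UBases (x : ℝ) : Set ℝ := {q | 1 < q ∧ q < 2 ∧ HasUniqueExpansion q x}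

/-- `q_s(x) = inf U(x)`. -/
def qs (x : ℝ) : ℝ := sInf (UBases x)

/-- The univoque set `U_q` of `x ∈ [0, 1/(q-1)]` with a unique `q`-expansion. -/
def Uset (q : ℝ) : Set ℝ :=
  {x | x ∈ Set.Icc 0 (1 / (q - 1)) ∧ HasUniqueExpansion q x}

/-- The set `U_q'` of digit sequences which are the unique `q`-expansion of their value. -/
def USeq (q : ℝ) : Set (ℕ → ℕ) :=
  {d | (∀ i, d i ≤ 1) ∧ ∀ e : ℕ → ℕ, IsExpansion q (seqVal q d) e → e = d}

/-- The Thue–Morse sequence: `τ 0 = 0`, `τ (2n) = τ n`, `τ (2n+1) = 1 - τ n`. -/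
def IsThueMorse (τ : ℕ → ℕ) : Prop :=
  τ 0 = 0 ∧ (∀ n, τ (2 * n) = τ n) ∧ ∀ n, τ (2 * n + 1) = 1 - τ n

/-- `q` is the Komornik–Loreti constant: the base in `(1,2)` with `1 = Σ_{i≥1} τ_i q^{-i}`. -/
def IsKL (τ : ℕ → ℕ) (q : ℝ) : Prop :=
  1 < q ∧ q < 2 ∧ (1 : ℝ) = ∑' i : ℕ, (τ (i + 1) : ℝ) / q ^ (i + 1)

/-- `Q` is the sequence of bases `q_n`: `Q 0 = 1` and for `n ≥ 1`, `Q n` is the root in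
`(1,2)` of `1 = Σ_{i=1}^{2^n} τ_i q^{-i}`. -/
def IsBaseSeq (τ : ℕ → ℕ) (Q : ℕ → ℝ) : Prop :=
  Q 0 = 1 ∧ ∀ n, 1 ≤ n → 1 < Q n ∧ Q n < 2 ∧
    (1 : ℝ) = ∑ i ∈ Finset.range (2 ^ n), (τ (i + 1) : ℝ) / (Q n) ^ (i + 1)

/-- `D_n = ⋃_{q ∈ (q_{n-1}, q_n]} U_q`. -/
def D (Q : ℕ → ℝ) (n : ℕ) : Set ℝ := ⋃ q ∈ Set.Ioc (Q (n - 1)) (Q n), Uset q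

/-- The golden ratio. -/
def qG : ℝ := (1 + Real.sqrt 5) / 2

/-- Strict lexicographical order on digit sequences. -/
def seqLt (c d : ℕ → ℕ) : Prop := ∃ n, (∀ i, i < n → c i = d i) ∧ c n < d n

/-- The word `τ_1 ⋯ τ_m`. -/
def tmPrefix (τ : ℕ → ℕ) (m : ℕ) : List ℕ := (List.range m).map fun i => τ (i + 1)

/-- `w⁻`: decrease the last digit of a word by 1. -/
def lastDec (w : List ℕ) : List ℕ := w.dropLast ++ [w.getLastD 0 - 1]

/-- `w⁺`: increase the last digit of a word by 1. -/
def lastInc (w : List ℕ) : List ℕ := w.dropLast ++ [w.getLastD 0 + 1]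

/-- The reflection of a word. -/
def reflect (w : List ℕ) : List ℕ := w.map fun d => 1 - d

/-- The infinite sequence given by the prefix `p` followed by periodic repetition of `w`. -/
def prefPeriodic (p w : List ℕ) : ℕ → ℕ := fun j =>
  if j < p.length then p.getD j 0 else w.getD ((j - p.length) % w.length) 0

/-- `z_n = ((τ_1⋯τ_{2^{n-1}})(τ_{2^{n-1}+1}⋯τ_{2^n})^∞)_{q_n}`. -/
def zVal (τ : ℕ → ℕ) (Q : ℕ → ℝ) (n : ℕ) : ℝ :=
  seqVal (Q n) (prefPeriodic (tmPrefix τ (2 ^ (n - 1)))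
    ((List.range (2 ^ (n - 1))).map fun i => τ (2 ^ (n - 1) + (i + 1))))

/-- `z_{1,k} = Σ_{i=1}^k q_G^{-i} + 1/(q_G^k (q_G^2 - 1))`. -/
def z1 (k : ℕ) : ℝ :=
  (∑ i ∈ Finset.range k, 1 / qG ^ (i + 1)) + 1 / (qG ^ k * (qG ^ 2 - 1))

/-! ### Basic facts on expansions -/

def consSeq (a : ℕ) (d : ℕ → ℕ) : ℕ → ℕ := fun n => Nat.casesOn n a d

def tailSeq (d : ℕ → ℕ) : ℕ → ℕ := fun n => d (n + 1)

lemma summable_digits {q : ℝ} (hq : 1 < q) {d : ℕ → ℕ} (hd : ∀ i, d i ≤ 1) :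
    Summable (fun i : ℕ => (d i : ℝ) / q ^ (i + 1)) := by
  have hg : Summable (fun i : ℕ => (1 / q) ^ i) :=
    summable_geometric_of_lt_one (by positivity) (by rw [div_lt_one] <;> linarith)
  refine Summable.of_nonneg_of_le (fun i => by positivity) (fun i => ?_) hg
  have h1 : (d i : ℝ) ≤ 1 := by exact_mod_cast hd i
  rw [one_div, inv_pow, ← one_div]
  have h0 : 0 < q ^ i := by positivity
  apply div_le_div₀ zero_le_one h1 h0
  exact pow_le_pow_right₀ hq.le (Nat.le_succ i)

lemma seqVal_step {q : ℝ} (hq : 1 < q) {d : ℕ → ℕ} (hd : ∀ i, d i ≤ 1) :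
    seqVal q d = ((d 0 : ℝ) + seqVal q (tailSeq d)) / q := by
  unfold seqVal
  rw [(summable_digits hq hd).tsum_eq_zero_add, add_div, ← tsum_div_const]
  congr 1
  · simp
  · congr 1
    ext i
    simp only [tailSeq]
    rw [pow_succ q (i + 1), div_div]

lemma tail_le {d : ℕ → ℕ} (hd : ∀ i, d i ≤ 1) : ∀ i, tailSeq d i ≤ 1 := fun i => hd (i + 1)

lemma cons_le {a : ℕ} (ha : a ≤ 1) {d : ℕ → ℕ} (hd : ∀ i, d i ≤ 1) :
    ∀ i, consSeq a d i ≤ 1 := by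
  intro i
  cases i with
  | zero => exact ha
  | succ n => exact hd n

lemma tail_cons (a : ℕ) (d : ℕ → ℕ) : tailSeq (consSeq a d) = d := rfl

lemma seqVal_cons {q : ℝ} (hq : 1 < q) {a : ℕ} (ha : a ≤ 1) {d : ℕ → ℕ} (hd : ∀ i, d i ≤ 1) :
    seqVal q (consSeq a d) = ((a : ℝ) + seqVal q d) / q := by
  rw [seqVal_step hq (cons_le ha hd), tail_cons]
  rfl

lemma seqVal_nonneg {q : ℝ} (hq : 1 < q) (d : ℕ → ℕ) : 0 ≤ seqVal q d :=
  tsum_nonneg (fun i => by positivity)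

lemma seqVal_one {q : ℝ} (hq : 1 < q) : seqVal q (fun _ => 1) = 1 / (q - 1) := by
  have h := seqVal_step hq (d := fun _ => 1) (fun _ => le_rfl)
  have ht : tailSeq (fun _ => 1) = fun _ => 1 := rfl
  rw [ht] at h
  have h1 : q - 1 ≠ 0 := by linarith
  have h2 : q ≠ 0 := by linarith
  rw [eq_div_iff h2] at h
  rw [eq_div_iff h1]
  push_cast at h
  linarith

lemma seqVal_le {q : ℝ} (hq : 1 < q) {d : ℕ → ℕ} (hd : ∀ i, d i ≤ 1) :
    seqVal q d ≤ 1 / (q - 1) := by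
  rw [← seqVal_one hq]
  refine (summable_digits hq hd).tsum_le_tsum (fun i => ?_)
    (summable_digits hq (d := fun _ => 1) (fun _ => le_rfl))
  have h1 : (d i : ℝ) ≤ ((1 : ℕ) : ℝ) := by exact_mod_cast hd i
  have h0 : 0 < q ^ (i + 1) := by positivity
  gcongr

/-- Greedy orbit. -/
def orbit (q y : ℝ) : ℕ → ℝ
  | 0 => y
  | n + 1 => if 1 ≤ q * orbit q y n then q * orbit q y n - 1 else q * orbit q y n

def greedy (q y : ℝ) (n : ℕ) : ℕ := if 1 ≤ q * orbit q y n then 1 else 0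

lemma orbit_mem {q y : ℝ} (hq : 1 < q) (hq2 : q < 2) (h0 : 0 ≤ y) (h1 : y ≤ 1 / (q - 1)) (n : ℕ) :
    0 ≤ orbit q y n ∧ orbit q y n ≤ 1 / (q - 1) := by
  have hp : 0 < q - 1 := by linarith
  induction n with
  | zero => exact ⟨h0, h1⟩
  | succ n ih =>
    obtain ⟨ih0, ih1⟩ := ih
    rw [le_div_iff₀ hp] at ih1
    simp only [orbit]
    split_ifs with h
    · refine ⟨by linarith, ?_⟩
      rw [le_div_iff₀ hp]
      nlinarith
    · refine ⟨by positivity, ?_⟩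
      rw [le_div_iff₀ hp]
      push Not at h
      nlinarith

lemma greedy_sum {q y : ℝ} (hq : 1 < q) (n : ℕ) :
    ∑ i ∈ Finset.range n, (greedy q y i : ℝ) / q ^ (i + 1) = y - orbit q y n / q ^ n := by
  induction n with
  | zero => simp [orbit]
  | succ n ih =>
    have h0 : q ≠ 0 := by linarith
    rw [Finset.sum_range_succ, ih]
    simp only [greedy, orbit]
    split_ifs
    · push_cast
      field_simp
      ring
    · push_cast
      field_simp
      ring

lemma exists_expansion {q y : ℝ} (hq : 1 < q) (hq2 : q < 2) (h0 : 0 ≤ y) (h1 : y ≤ 1 / (q - 1)) :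
    ∃ e : ℕ → ℕ, (∀ i, e i ≤ 1) ∧ seqVal q e = y := by
  have hd : ∀ i, greedy q y i ≤ 1 := by
    intro i
    unfold greedy
    split_ifs <;> simp
  refine ⟨greedy q y, hd, ?_⟩
  have hs := (summable_digits hq hd).hasSum.tendsto_sum_nat
  have ht : Tendsto (fun n => ∑ i ∈ Finset.range n, (greedy q y i : ℝ) / q ^ (i + 1)) atTop
      (𝓝 (y - 0)) := by
    simp_rw [greedy_sum hq]
    refine tendsto_const_nhds.sub ?_
    have hg : Tendsto (fun n : ℕ => 1 / (q - 1) * (1 / q) ^ n) atTop (𝓝 (1 / (q - 1) * 0)) :=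
      (tendsto_pow_atTop_nhds_zero_of_lt_one (by positivity)
        (by rw [div_lt_one] <;> linarith)).const_mul _
    rw [mul_zero] at hg
    refine squeeze_zero (fun n => ?_) (fun n => ?_) hg
    · have := (orbit_mem hq hq2 h0 h1 n).1
      positivity
    · have := (orbit_mem hq hq2 h0 h1 n).2
      rw [one_div q, inv_pow, ← div_eq_mul_inv]
      have h0 : 0 < q ^ n := by positivity
      gcongr
  rw [sub_zero] at ht
  exact tendsto_nhds_unique hs ht

/-- `d` is univoque in base `q`. -/
def Univ (q : ℝ) (d : ℕ → ℕ) : Prop :=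
  (∀ i, d i ≤ 1) ∧ ∀ e : ℕ → ℕ, (∀ i, e i ≤ 1) → seqVal q e = seqVal q d → e = d

lemma Univ.tail {q : ℝ} (hq : 1 < q) {d : ℕ → ℕ} (h : Univ q d) : Univ q (tailSeq d) := by
  refine ⟨tail_le h.1, fun e he hv => ?_⟩
  have h1 := h.2 (consSeq (d 0) e) (cons_le (h.1 0) he)
    (by rw [seqVal_cons hq (h.1 0) he, hv, ← seqVal_step hq h.1])
  rw [← h1, tail_cons]

lemma Univ.zero_lt {q : ℝ} (hq : 1 < q) (hq2 : q < 2) {d : ℕ → ℕ} (h : Univ q d) (h0 : d 0 = 0) :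
    seqVal q (tailSeq d) < 1 := by
  by_contra! hc
  obtain ⟨e, he, hv⟩ := exists_expansion (y := seqVal q (tailSeq d) - 1) hq hq2 (by linarith)
    (by linarith [seqVal_le hq (tail_le h.1)])
  have h1 := h.2 (consSeq 1 e) (cons_le le_rfl he) (by
    rw [seqVal_cons hq le_rfl he, hv, seqVal_step hq h.1, h0]
    push_cast
    congr 1
    ring)
  have h2 := congrFun h1 0
  rw [h0] at h2
  exact absurd h2 (by simp [consSeq])

lemma Univ.one_lt {q : ℝ} (hq : 1 < q) (hq2 : q < 2) {d : ℕ → ℕ} (h : Univ q d) (h0 : d 0 = 1) :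
    1 / (q - 1) - 1 < seqVal q (tailSeq d) := by
  by_contra! hc
  obtain ⟨e, he, hv⟩ := exists_expansion (y := seqVal q (tailSeq d) + 1) hq hq2
    (by linarith [seqVal_nonneg hq (tailSeq d)])
    (by linarith)
  have h1 := h.2 (consSeq 0 e) (cons_le (by norm_num) he) (by
    rw [seqVal_cons hq (by norm_num) he, hv, seqVal_step hq h.1, h0]
    push_cast
    congr 1
    ring)
  have h2 := congrFun h1 0
  rw [h0] at h2
  exact absurd h2 (by simp [consSeq])

/-- Characterisation by a set of sequences closed under tails. -/
lemma univ_of_closed {q : ℝ} (hq : 1 < q) (S : Set (ℕ → ℕ))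
    (hS : ∀ d ∈ S, (∀ i, d i ≤ 1) ∧ tailSeq d ∈ S ∧ (d 0 = 0 → seqVal q (tailSeq d) < 1) ∧
      (d 0 = 1 → 1 / (q - 1) - 1 < seqVal q (tailSeq d))) {d : ℕ → ℕ} (hd : d ∈ S) :
    Univ q d := by
  have hq0 : q ≠ 0 := by linarith
  have key : ∀ n : ℕ, ∀ d ∈ S, ∀ e : ℕ → ℕ, (∀ i, e i ≤ 1) → seqVal q e = seqVal q d →
      e n = d n := by
    intro n
    have first : ∀ d ∈ S, ∀ e : ℕ → ℕ, (∀ i, e i ≤ 1) → seqVal q e = seqVal q d →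
        e 0 = d 0 ∧ seqVal q (tailSeq e) = seqVal q (tailSeq d) := by
      intro d hd e he hv
      obtain ⟨hd1, -, hz, ho⟩ := hS d hd
      rw [seqVal_step hq he, seqVal_step hq hd1, div_left_inj' hq0] at hv
      have hb1 := seqVal_nonneg hq (tailSeq e)
      have hb2 := seqVal_le hq (tail_le he)
      have h01 : e 0 = 0 ∨ e 0 = 1 := by have := he 0; omega
      have h02 : d 0 = 0 ∨ d 0 = 1 := by have := hd1 0; omega
      rcases h01 with h1 | h1 <;> rcases h02 with h2 | h2 <;> rw [h1, h2] at hv <;>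
        push_cast at hv
      · exact ⟨by rw [h1, h2], by linarith⟩
      · have := ho h2
        linarith
      · have := hz h2
        linarith
      · exact ⟨by rw [h1, h2], by linarith⟩
    induction n with
    | zero => exact fun d hd e he hv => (first d hd e he hv).1
    | succ n ih =>
      intro d hd e he hv
      exact ih (tailSeq d) (hS d hd).2.1 (tailSeq e) (tail_le he) (first d hd e he hv).2
  exact ⟨(hS d hd).1, fun e he hv => funext fun n => key n d hd e he hv⟩

/-! ### The sequences `1^j (01)^∞` -/

def alt1 : ℕ → ℕ → ℕ
  | 0 => fun i => i % 2
  | j + 1 => consSeq 1 (alt1 j)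

/-- value of `1^j (01)^∞`. -/
def fv : ℕ → ℝ → ℝ
  | 0 => fun q => 1 / (q ^ 2 - 1)
  | j + 1 => fun q => (1 + fv j q) / q

lemma alt1_le (j : ℕ) : ∀ i, alt1 j i ≤ 1 := by
  induction j with
  | zero => intro i; simp only [alt1]; omega
  | succ j ih => exact cons_le le_rfl ih

lemma tail_sq_zero : tailSeq (alt1 0) = alt1 1 := by
  funext i
  cases i with
  | zero => rfl
  | succ n => simp only [tailSeq, alt1, consSeq]; omega

lemma seqVal_sq {q : ℝ} (hq : 1 < q) (j : ℕ) : seqVal q (alt1 j) = fv j q := by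
  induction j with
  | zero =>
    have h := seqVal_step hq (alt1_le 0)
    rw [tail_sq_zero] at h
    have h2 : seqVal q (alt1 1) = (((1 : ℕ) : ℝ) + seqVal q (alt1 0)) / q :=
      seqVal_cons hq le_rfl (alt1_le 0)
    rw [h2] at h
    have h3 : alt1 0 0 = 0 := rfl
    rw [h3] at h
    have hq0 : q ≠ 0 := by linarith
    have hq1 : q ^ 2 - 1 ≠ 0 := by nlinarith
    simp only [fv]
    rw [eq_div_iff hq1]
    field_simp at h
    push_cast at h
    linarith
  | succ j ih =>
    have h2 : seqVal q (alt1 (j + 1)) = (((1 : ℕ) : ℝ) + seqVal q (alt1 j)) / q :=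
      seqVal_cons hq le_rfl (alt1_le j)
    rw [h2, ih]
    simp [fv]

lemma fv_eq {q : ℝ} (hq : 1 < q) (j : ℕ) :
    (∑ i ∈ Finset.range j, 1 / q ^ (i + 1)) + 1 / (q ^ j * (q ^ 2 - 1)) = fv j q := by
  have hq0 : q ≠ 0 := by linarith
  have hq1 : q ^ 2 - 1 ≠ 0 := by nlinarith
  induction j with
  | zero => simp [fv]
  | succ j ih =>
    simp only [fv]
    rw [← ih, Finset.sum_range_succ', add_div, add_div, Finset.sum_div, div_div]
    simp_rw [div_div, ← pow_succ]
    have : q ^ j * (q ^ 2 - 1) * q = q ^ (j + 1) * (q ^ 2 - 1) := by ring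
    rw [this]
    simp
    ring

lemma fv_pos {q : ℝ} (hq : 1 < q) (j : ℕ) : 0 < fv j q := by
  induction j with
  | zero =>
    simp only [fv]
    have : 0 < q ^ 2 - 1 := by nlinarith
    positivity
  | succ j ih =>
    simp only [fv]
    positivity

lemma fv_anti {p q : ℝ} (hp : 1 < p) (hpq : p < q) (j : ℕ) : fv j q < fv j p := by
  induction j with
  | zero =>
    simp only [fv]
    have : 0 < p ^ 2 - 1 := by nlinarith
    apply one_div_lt_one_div_of_lt this
    nlinarith
  | succ j ih =>
    simp only [fv]
    have h1 := fv_pos (hp.trans hpq) j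
    have h2 := fv_pos hp j
    apply div_lt_div₀ <;> linarith

lemma fv_lt {q : ℝ} (hq : 1 < q) (j : ℕ) : fv j q < 1 / (q - 1) := by
  have hp : 0 < q - 1 := by linarith
  induction j with
  | zero =>
    simp only [fv]
    apply one_div_lt_one_div_of_lt hp
    nlinarith
  | succ j ih =>
    simp only [fv]
    rw [lt_div_iff₀ hp] at ih
    rw [div_lt_div_iff₀ (by linarith) hp]
    linarith

lemma fv_mono {q : ℝ} (hq : 1 < q) : StrictMono (fun j => fv j q) := by
  apply strictMono_nat_of_lt_succ
  intro j
  have hp : 0 < q - 1 := by linarith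
  have h := fv_lt hq j
  rw [lt_div_iff₀ hp] at h
  simp only [fv]
  rw [lt_div_iff₀ (by linarith)]
  linarith

lemma fv_cont (j : ℕ) : ContinuousOn (fv j) (Set.Ioi 1) := by
  induction j with
  | zero =>
    simp only [fv]
    refine continuousOn_const.div (by fun_prop) (fun q hq => ?_)
    have : (1 : ℝ) < q := hq
    nlinarith
  | succ j ih =>
    simp only [fv]
    refine (continuousOn_const.add ih).div continuousOn_id (fun q hq => ?_)
    have : (1 : ℝ) < q := hq
    linarith

lemma univ_sq {q : ℝ} (hq : 1 < q) (hG : 0 < q ^ 2 - q - 1) (j : ℕ) : Univ q (alt1 j) := by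
  have hp : 0 < q - 1 := by linarith
  have hp2 : 0 < q ^ 2 - 1 := by nlinarith
  refine univ_of_closed hq (Set.range alt1) ?_ ⟨j, rfl⟩
  rintro _ ⟨j, rfl⟩
  cases j with
  | zero =>
    refine ⟨alt1_le 0, ⟨1, tail_sq_zero.symm⟩, fun _ => ?_, fun h => ?_⟩
    · rw [tail_sq_zero, seqVal_sq hq]
      simp only [fv]
      rw [div_lt_one (by linarith), ← lt_sub_iff_add_lt', div_lt_iff₀ hp2]
      nlinarith
    · exact absurd h (by simp [alt1])
  | succ j =>
    refine ⟨alt1_le _, ⟨j, rfl⟩, fun h => ?_, fun _ => ?_⟩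
    · exact absurd h (by simp [alt1, consSeq])
    · have : tailSeq (alt1 (j + 1)) = alt1 j := rfl
      rw [this, seqVal_sq hq]
      refine lt_of_lt_of_le ?_ ((fv_mono hq).monotone (Nat.zero_le j))
      simp only [fv]
      rw [sub_lt_iff_lt_add, div_lt_iff₀ hp, add_mul, div_mul_eq_mul_div, ← sub_lt_iff_lt_add,
        lt_div_iff₀ hp2]
      nlinarith

/-! ### Forbidden words -/

lemma no_10 {q : ℝ} (hq : 1 < q) (hq2 : q < 2) {d : ℕ → ℕ} (h : Univ q d) (h0 : d 0 = 1)
    (h1 : d 1 = 0) : 0 < q ^ 2 - q - 1 := by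
  have hp : 0 < q - 1 := by linarith
  have a := h.one_lt hq hq2 h0
  have b := (h.tail hq).zero_lt hq hq2 h1
  have c := seqVal_step hq (tail_le h.1)
  have h1' : tailSeq d 0 = 0 := h1
  rw [h1', eq_div_iff (by linarith)] at c
  push_cast at c
  rw [sub_lt_iff_lt_add, div_lt_iff₀ hp] at a
  nlinarith

lemma no_100 {q : ℝ} (hq : 1 < q) (hq2 : q < 2) {d : ℕ → ℕ} (h : Univ q d) (h0 : d 0 = 1)
    (h1 : d 1 = 0) (h2 : d 2 = 0) : 0 < q ^ 3 - 2 * q ^ 2 + q - 1 := by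
  have hp : 0 < q - 1 := by linarith
  have a := h.one_lt hq hq2 h0
  have b := ((h.tail hq).tail hq).zero_lt hq hq2 h2
  have c := seqVal_step hq (tail_le h.1)
  have c2 := seqVal_step hq (tail_le (tail_le h.1))
  have h1' : tailSeq d 0 = 0 := h1
  have h2' : tailSeq (tailSeq d) 0 = 0 := h2
  rw [h1', eq_div_iff (by linarith)] at c
  rw [h2', eq_div_iff (by linarith)] at c2
  push_cast at c c2
  rw [sub_lt_iff_lt_add, div_lt_iff₀ hp] at a
  set y := seqVal q (tailSeq d)
  have e : y * q ^ 2 < 1 := by nlinarith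
  have a2 : q ^ 2 * 1 < q ^ 2 * ((y + 1) * (q - 1)) := by gcongr
  have e2 : y * q ^ 2 * (q - 1) < 1 * (q - 1) := by gcongr
  nlinarith

lemma no_011 {q : ℝ} (hq : 1 < q) (hq2 : q < 2) {d : ℕ → ℕ} (h : Univ q d) (h0 : d 0 = 0)
    (h1 : d 1 = 1) (h2 : d 2 = 1) : 0 < q ^ 3 - 2 * q ^ 2 + q - 1 := by
  have hp : 0 < q - 1 := by linarith
  have a := h.zero_lt hq hq2 h0
  have b := ((h.tail hq).tail hq).one_lt hq hq2 h2
  have c := seqVal_step hq (tail_le h.1)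
  have c2 := seqVal_step hq (tail_le (tail_le h.1))
  have h1' : tailSeq d 0 = 1 := h1
  have h2' : tailSeq (tailSeq d) 0 = 1 := h2
  rw [h1', eq_div_iff (by linarith)] at c
  rw [h2', eq_div_iff (by linarith)] at c2
  push_cast at c c2
  rw [sub_lt_iff_lt_add, div_lt_iff₀ hp] at b
  set y := seqVal q (tailSeq d)
  set z := seqVal q (tailSeq (tailSeq (tailSeq d)))
  have e : z = y * q ^ 2 - q - 1 := by nlinarith
  have e2 : y * q ^ 2 < 1 * q ^ 2 := by gcongr
  have e3 : z + 1 < q ^ 2 - q := by linarith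
  have e4 : (z + 1) * (q - 1) < (q ^ 2 - q) * (q - 1) := by gcongr
  nlinarith

/-- Classification of univoque sequences starting with `1` below `q_2`. -/
lemma classify {q : ℝ} (hq : 1 < q) (hq2 : q < 2) (hc : q ^ 3 - 2 * q ^ 2 + q - 1 ≤ 0)
    {d : ℕ → ℕ} (h : Univ q d) (h0 : d 0 = 1) :
    d = (fun _ => 1) ∨ (0 < q ^ 2 - q - 1 ∧ ∃ j, 1 ≤ j ∧ d = alt1 j) := by
  have hb : ∀ d, Univ q d → ∀ i, d i = 0 ∨ d i = 1 := fun d h i => by have := h.1 i; omega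
  -- a univoque sequence starting with 10 alternates
  have alt : ∀ n, (∀ d, Univ q d → d 0 = 1 → d 1 = 0 → d n = alt1 1 n) ∧
      (∀ d, Univ q d → d 0 = 0 → d 1 = 1 → d n = alt1 0 n) := by
    intro n
    induction n with
    | zero => exact ⟨fun d _ h0 _ => h0, fun d _ h0 _ => h0⟩
    | succ n ih =>
      constructor
      · intro d h h0 h1
        have h2 : d 2 = 1 := by
          rcases hb d h 2 with h2 | h2
          · linarith [no_100 hq hq2 h h0 h1 h2]
          · exact h2
        exact ih.2 (tailSeq d) (h.tail hq) h1 h2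
      · intro d h h0 h1
        have h2 : d 2 = 0 := by
          rcases hb d h 2 with h2 | h2
          · exact h2
          · linarith [no_011 hq hq2 h h0 h1 h2]
        have := ih.1 (tailSeq d) (h.tail hq) h1 h2
        rw [← tail_sq_zero] at this
        exact this
  have main : ∀ n, ∀ d, Univ q d → d 0 = 1 → d (n + 1) = 0 →
      (0 < q ^ 2 - q - 1 ∧ ∃ j, 1 ≤ j ∧ d = alt1 j) := by
    intro n
    induction n with
    | zero =>
      intro d h h0 h1
      exact ⟨no_10 hq hq2 h h0 h1, 1, le_rfl, funext fun n => (alt n).1 d h h0 h1⟩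
    | succ n ih =>
      intro d h h0 hn
      rcases hb d h 1 with h1 | h1
      · exact ⟨no_10 hq hq2 h h0 h1, 1, le_rfl, funext fun n => (alt n).1 d h h0 h1⟩
      · obtain ⟨hG, j, hj, hd⟩ := ih (tailSeq d) (h.tail hq) h1 hn
        refine ⟨hG, j + 1, by omega, ?_⟩
        funext i
        cases i with
        | zero => exact h0
        | succ i => exact congrFun hd i
  by_cases hall : ∀ n, d n = 1
  · left
    exact funext hall
  · right
    push Not at hall
    obtain ⟨n, hn⟩ := hall
    cases n with
    | zero => exact absurd h0 hn
    | succ n => exact main n d h h0 ((hb d h (n + 1)).resolve_right hn)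

/-! ### The main lemma -/

lemma qG_sq : qG ^ 2 = qG + 1 := by
  unfold qG
  have := Real.sq_sqrt (show (0 : ℝ) ≤ 5 by norm_num)
  nlinarith

lemma qG_lb : 1.618 < qG := by
  unfold qG
  have : (2.236 : ℝ) < Real.sqrt 5 := by
    apply Real.lt_sqrt_of_sq_lt
    norm_num
  linarith

lemma qG_ub : qG < 1.6181 := by
  unfold qG
  have : Real.sqrt 5 < 2.2362 := by
    rw [Real.sqrt_lt' (by norm_num)]
    norm_num
  linarith

lemma gt_qG {q : ℝ} (hq : 1 < q) (h : 0 < q ^ 2 - q - 1) : qG < q := by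
  have := qG_sq
  have := qG_lb
  nlinarith

lemma of_gt_qG {q : ℝ} (h : qG < q) : 0 < q ^ 2 - q - 1 := by
  have := qG_sq
  have := qG_lb
  nlinarith

lemma cubic_mono {p q : ℝ} (hp : 1 < p) (h : p < q) :
    p ^ 3 - 2 * p ^ 2 + p - 1 < q ^ 3 - 2 * q ^ 2 + q - 1 := by
  have e : q ^ 3 - 2 * q ^ 2 + q - 1 - (p ^ 3 - 2 * p ^ 2 + p - 1)
      = (q - p) * ((q - p) ^ 2 + 3 * p * (q - p) - 2 * (q - p) + (3 * p - 1) * (p - 1)) := by ring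
  have : 0 < (q - p) ^ 2 + (3 * p - 2) * (q - p) + (3 * p - 1) * (p - 1) := by
    have h1 : 0 < q - p := by linarith
    have h2 : 0 < 3 * p - 2 := by linarith
    have h3 : 0 < 3 * p - 1 := by linarith
    have h4 : 0 < p - 1 := by linarith
    positivity
  have := mul_pos (show 0 < q - p by linarith) this
  nlinarith

lemma fv_one_qG : fv 1 qG = 1 := by
  have h1 := qG_sq
  have h2 := qG_lb
  simp only [fv]
  have : qG ^ 2 - 1 = qG := by linarith
  rw [this]
  have h0 : qG ≠ 0 := by linarith
  field_simp
  linarith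

lemma qs_eq {q x : ℝ} {k : ℕ} (hk : 1 ≤ k) (hG : qG < q) (hq2 : q < 2)
    (hc : q ^ 3 - 2 * q ^ 2 + q - 1 ≤ 0) (hx : fv k qG ≤ x) (hxq : x = fv (k + 1) q) :
    qs x = q := by
  have hG1 := qG_lb
  have hq : 1 < q := by linarith
  have hx1 : 1 ≤ x := by
    rw [← fv_one_qG]
    exact ((fv_mono (by linarith : 1 < qG)).monotone hk).trans hx
  have hmem : q ∈ UBases x := by
    refine ⟨hq, hq2, alt1 (k + 1), ⟨alt1_le _, by rw [seqVal_sq hq, hxq]⟩, ?_⟩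
    rintro e ⟨he, hv⟩
    exact (univ_sq hq (of_gt_qG hG) (k + 1)).2 e he (by rw [← hv, seqVal_sq hq, hxq])
  have hlb : ∀ p ∈ UBases x, q ≤ p := by
    rintro p ⟨hp, hp2, d, ⟨hd, hv⟩, hu⟩
    by_contra! hpq
    have hU : Univ p d := ⟨hd, fun e he hev => hu e ⟨he, by rw [hev, hv]⟩⟩
    have hd0 : d 0 = 1 := by
      by_contra hne
      have h0 : d 0 = 0 := by have := hd 0; omega
      have h1 := hU.zero_lt hp hp2 h0
      have h2 := seqVal_step hp hd
      rw [h0, ← hv, eq_div_iff (by linarith)] at h2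
      push_cast at h2
      nlinarith
    have hlt : x < fv (k + 1) p := by
      rw [hxq]
      exact fv_anti hp hpq _
    have hpc := cubic_mono hp hpq
    rcases classify hp hp2 (by linarith) hU hd0 with h | ⟨hpG, j, hj, h⟩
    · rw [h, seqVal_one hp] at hv
      have := fv_lt hp (k + 1)
      linarith
    · rw [h, seqVal_sq hp] at hv
      rcases le_or_gt j k with hjk | hjk
      · have h1 : fv j p ≤ fv k p := (fv_mono hp).monotone hjk
        have h2 := fv_anti (by linarith) (gt_qG hp hpG) k
        linarith
      · have h1 : fv (k + 1) p ≤ fv j p := (fv_mono hp).monotone hjk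
        linarith
  exact le_antisymm (csInf_le ⟨q, hlb⟩ hmem) (le_csInf ⟨q, hmem⟩ hlb)

lemma exists_root {x r : ℝ} {k : ℕ} (hr : qG < r) (h1 : fv k r ≤ x) (h2 : x < fv k qG) :
    ∃ q ∈ Set.Ioc qG r, x = fv k q := by
  have hG1 := qG_lb
  have hcont : ContinuousOn (fv k) (Set.Icc qG r) :=
    (fv_cont k).mono (fun y hy => by
      have := hy.1
      show 1 < y
      linarith)
  obtain ⟨q, hq, hv⟩ := intermediate_value_Icc' hr.le hcont ⟨h1, h2.le⟩
  refine ⟨q, ⟨lt_of_le_of_ne hq.1 ?_, hq.2⟩, hv.symm⟩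
  rintro rfl
  linarith

lemma tm_vals {τ : ℕ → ℕ} (hτ : IsThueMorse τ) : τ 1 = 1 ∧ τ 2 = 1 ∧ τ 3 = 0 ∧ τ 4 = 1 := by
  obtain ⟨h0, he, ho⟩ := hτ
  have a1 := ho 0
  have a2 := he 1
  have a3 := ho 1
  have a4 := he 2
  norm_num at a1 a2 a3 a4
  refine ⟨?_, ?_, ?_, ?_⟩ <;> omega

lemma Q1_eq {τ : ℕ → ℕ} (hτ : IsThueMorse τ) {Q : ℕ → ℝ} (hQ : IsBaseSeq τ Q) : Q 1 = qG := by
  obtain ⟨t1, t2, -, -⟩ := tm_vals hτ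
  obtain ⟨h1, -, h3⟩ := hQ.2 1 le_rfl
  norm_num [Finset.sum_range_succ, t1, t2] at h3
  have h0 : Q 1 ≠ 0 := by linarith
  field_simp at h3
  have a := qG_sq
  have b := qG_lb
  have : (Q 1 - qG) * (Q 1 + qG - 1) = 0 := by nlinarith
  rcases mul_eq_zero.mp this with h | h <;> linarith

lemma Q2_cubic {τ : ℕ → ℕ} (hτ : IsThueMorse τ) {Q : ℕ → ℝ} (hQ : IsBaseSeq τ Q) :
    Q 2 ^ 3 - 2 * Q 2 ^ 2 + Q 2 - 1 = 0 := by
  obtain ⟨t1, t2, t3, t4⟩ := tm_vals hτ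
  obtain ⟨h1, -, h3⟩ := hQ.2 2 (by norm_num)
  norm_num [Finset.sum_range_succ, t1, t2, t3, t4] at h3
  have h0 : Q 2 ≠ 0 := by linarith
  field_simp at h3
  have : (Q 2 + 1) * (Q 2 ^ 3 - 2 * Q 2 ^ 2 + Q 2 - 1) = 0 := by nlinarith
  rcases mul_eq_zero.mp this with h | h
  · linarith
  · exact h

lemma zVal_two {τ : ℕ → ℕ} (hτ : IsThueMorse τ) {Q : ℕ → ℝ} (hQ : IsBaseSeq τ Q) :
    zVal τ Q 2 = fv 2 (Q 2) := by
  obtain ⟨t1, t2, t3, t4⟩ := tm_vals hτ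
  rw [← seqVal_sq (hQ.2 2 (by norm_num)).1]
  unfold zVal
  congr 1
  have e1 : tmPrefix τ (2 ^ (2 - 1)) = [1, 1] := by
    simp [tmPrefix, List.range_succ, t1, t2]
  have e2 : ((List.range (2 ^ (2 - 1))).map fun i => τ (2 ^ (2 - 1) + (i + 1))) = [0, 1] := by
    simp [List.range_succ, t3, t4]
  rw [e1, e2]
  funext i
  match i with
  | 0 => rfl
  | 1 => rfl
  | n + 2 =>
    have : alt1 2 (n + 2) = n % 2 := rfl
    rw [this]
    simp only [prefPeriodic, List.length_cons, List.length_nil]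
    rw [if_neg (by omega)]
    have h : n + 2 - (0 + 1 + 1) = n := by omega
    rw [h]
    rcases Nat.mod_two_eq_zero_or_one n with h | h <;> simp [h]

lemma fv_key {r : ℝ} (hr : 1.75 < r) {k : ℕ} (hk : 2 ≤ k) : fv (k + 1) r < fv k qG := by
  have hG := qG_lb
  have hG' := qG_ub
  have hs := qG_sq
  have hs1 : qG ^ 2 - 1 = qG := by linarith
  have e2 : 1.23 < fv 2 qG := by
    simp only [fv]
    rw [hs1, lt_div_iff₀ (by linarith), ← sub_lt_iff_lt_add', lt_div_iff₀ (by linarith),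
      ← sub_lt_iff_lt_add', lt_div_iff₀ (by linarith)]
    nlinarith
  rcases hk.eq_or_lt with rfl | hk3
  · have h1 := fv_anti (by norm_num : (1 : ℝ) < 1.75) hr 3
    have h2 : fv 3 1.75 < 1.23 := by
      simp only [fv]
      norm_num
    exact (h1.trans h2).trans e2
  · have h1 := fv_lt (by linarith : 1 < r) (k + 1)
    have h2 : 1 / (r - 1) < 1.34 := by
      rw [div_lt_iff₀ (by linarith)]
      linarith
    have h3 : fv 3 qG ≤ fv k qG := (fv_mono (by linarith : 1 < qG)).monotone hk3
    have h4 : 1.34 < fv 3 qG := by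
      have : fv 3 qG = (1 + fv 2 qG) / qG := rfl
      rw [this, lt_div_iff₀ (by linarith)]
      linarith
    linarith

/-- For `k ≥ 2` and `x ∈ [z_{1,k}, z_{1,k+1})`, `q_s(x)` is the unique root
in `(q_1, q_2)` of `x = Σ_{i=1}^{k+1} q^{-i} + 1/(q^{k+1}(q²-1))`; for `x ∈ [z_2, z_{1,2})`,
`q_s(x)` is the unique root in `(q_1, q_2]` of `x = 1/q + 1/q² + 1/(q²(q²-1))`. -/
theorem qs_root_characterization (τ : ℕ → ℕ) (hτ : IsThueMorse τ)
    (Q : ℕ → ℝ) (hQ : IsBaseSeq τ Q) :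
    (∀ k, 2 ≤ k → ∀ x ∈ Set.Ico (z1 k) (z1 (k + 1)),
      qs x ∈ Set.Ioo (Q 1) (Q 2) ∧
      x = (∑ i ∈ Finset.range (k + 1), 1 / (qs x) ^ (i + 1)) +
            1 / ((qs x) ^ (k + 1) * ((qs x) ^ 2 - 1)) ∧
      ∀ q ∈ Set.Ioo (Q 1) (Q 2),
        x = (∑ i ∈ Finset.range (k + 1), 1 / q ^ (i + 1)) +
              1 / (q ^ (k + 1) * (q ^ 2 - 1)) → q = qs x) ∧
    (∀ x ∈ Set.Ico (zVal τ Q 2) (z1 2),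
      qs x ∈ Set.Ioc (Q 1) (Q 2) ∧
      x = 1 / qs x + 1 / (qs x) ^ 2 + 1 / ((qs x) ^ 2 * ((qs x) ^ 2 - 1)) ∧
      ∀ q ∈ Set.Ioc (Q 1) (Q 2),
        x = 1 / q + 1 / q ^ 2 + 1 / (q ^ 2 * (q ^ 2 - 1)) → q = qs x) := by
  have hQ1 := Q1_eq hτ hQ
  have hQ2c := Q2_cubic hτ hQ
  obtain ⟨hQ2a, hQ2b, -⟩ := hQ.2 2 (by norm_num)
  have hlo : 1.75 < Q 2 := by
    by_contra! h
    rcases h.eq_or_lt with h | h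
    · rw [h] at hQ2c
      norm_num at hQ2c
    · have := cubic_mono hQ2a h
      norm_num at this hQ2c
      linarith
  have hhi : Q 2 < 1.76 := by
    by_contra! h
    rcases h.eq_or_lt with h | h
    · rw [← h] at hQ2c
      norm_num at hQ2c
    · have := cubic_mono (by norm_num) h
      norm_num at this hQ2c
      linarith
  have hGl := qG_lb
  have hGu := qG_ub
  have hG1 : 1 < qG := by linarith
  have hz : ∀ k, z1 k = fv k qG := fun k => fv_eq hG1 k
  have hcub : ∀ q, 1 < q → q ≤ Q 2 → q ^ 3 - 2 * q ^ 2 + q - 1 ≤ 0 := by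
    intro q h1 h2
    rcases h2.eq_or_lt with h | h
    · rw [h]
      linarith
    · have := cubic_mono h1 h
      linarith
  rw [hQ1]
  constructor
  · rintro k hk x ⟨hx1, hx2⟩
    rw [hz] at hx1 hx2
    have hkey := fv_key hlo hk
    obtain ⟨q, ⟨hqa, hqb⟩, hxq⟩ := exists_root (by linarith : qG < Q 2)
      (by linarith : fv (k + 1) (Q 2) ≤ x) hx2
    have hqs : ∀ p, qG < p → p ≤ Q 2 → x = fv (k + 1) p → qs x = p := fun p h1 h2 h3 =>
      qs_eq (by omega) h1 (by linarith) (hcub p (by linarith) h2) hx1 h3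
    have hqx := hqs q hqa hqb hxq
    rw [hqx]
    refine ⟨⟨hqa, lt_of_le_of_ne hqb ?_⟩, ?_, ?_⟩
    · rintro rfl
      linarith
    · rw [fv_eq (by linarith)]
      exact hxq
    · rintro p ⟨hp1, hp2⟩ hp
      rw [fv_eq (by linarith)] at hp
      rw [← hqx]
      exact (hqs p hp1 hp2.le hp).symm
  · rintro x ⟨hx1, hx2⟩
    rw [hz] at hx2
    rw [zVal_two hτ hQ] at hx1
    have hone : fv 1 qG ≤ x := by
      rw [fv_one_qG]
      have h1 := fv_anti hQ2a hhi 2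
      have h2 : 1 < fv 2 1.76 := by
        simp only [fv]
        norm_num
      linarith
    obtain ⟨q, ⟨hqa, hqb⟩, hxq⟩ := exists_root (by linarith : qG < Q 2) hx1 hx2
    have hqs : ∀ p, qG < p → p ≤ Q 2 → x = fv 2 p → qs x = p := fun p h1 h2 h3 =>
      qs_eq le_rfl h1 (by linarith) (hcub p (by linarith) h2) hone h3
    have hf : ∀ p, 1 < p → 1 / p + 1 / p ^ 2 + 1 / (p ^ 2 * (p ^ 2 - 1)) = fv 2 p := by
      intro p hp
      rw [← fv_eq hp 2]
      simp [Finset.sum_range_succ]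
    have hqx := hqs q hqa hqb hxq
    rw [hqx]
    refine ⟨⟨hqa, hqb⟩, ?_, ?_⟩
    · rw [hf q (by linarith)]
      exact hxq
    · rintro p ⟨hp1, hp2⟩ hp
      rw [hf p (by linarith)] at hp
      rw [← hqx]
      exact (hqs p hp1 hp2 hp).symm
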